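/- arXiv:2003.07190 — 2 statements merged into one kernel-verified Lean document; each statement's English description precedes it below -/
import Mathlib

section
/- Let G be a digraph of order n with minimum out-degree at least 1 in which every vertex has out-degree at least 2 (i.e., t = 0 in Shen's theorem). Then G contains a directed cycle of length at most ⌈n/2⌉. -/
/-- A directed cycle of length `m` in the digraph with arc relation `A`. -/
def IsCycleOn {V : Type*} (A : V → V → Prop) (m : ℕ) (c : ZMod m → V) : Prop :=
  2 ≤ m ∧ Function.Injective c ∧ ∀ i, A (c i) (c (i + 1))

inductive WWalk {V : Type*} (A : V → V → Prop) (w : V → ℕ) (u : V) : V → ℕ → Prop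
  | nil : WWalk A w u u 0
  | snoc {v t : V} {m : ℕ} : WWalk A w u v m → A v t → WWalk A w u t (m + w v)

theorem WWalk.trans {V : Type*} {A : V → V → Prop} {w : V → ℕ} {a b c : V} {m k : ℕ}
    (h1 : WWalk A w a b m) (h2 : WWalk A w b c k) : WWalk A w a c (m + k) := by
  induction h2 with
  | nil => simpa using h1
  | snoc _ h ih => rw [← add_assoc]; exact ih.snoc h

theorem WWalk.of_rel {V : Type*} {A : V → V → Prop} {w : V → ℕ} {a b : V}
    (h : A a b) : WWalk A w a b (w a) := by
  simpa using (WWalk.nil (A := A) (w := w) (u := a)).snoc h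

/-- shortest path bound -/
theorem path_bound {V : Type*} [DecidableEq V] (A : V → V → Prop) (w : V → ℕ) (t : V) :
    ∀ (n : ℕ) (S : Finset V) (u : V), S.card = n → u ∈ S → t ∈ S →
      Relation.ReflTransGen (fun a b => A a b ∧ a ∈ S ∧ b ∈ S) u t →
      ∃ m, WWalk A w u t m ∧ m + w t ≤ ∑ v ∈ S, w v := by
  intro n
  induction n with
  | zero =>
    intro S u hc hu
    rw [Finset.card_eq_zero] at hc
    simp [hc] at hu
  | succ n ih =>
    intro S u hc hu ht h
    by_cases hut : u = t
    · subst hut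
      refine ⟨0, WWalk.nil, ?_⟩
      rw [zero_add]
      exact Finset.single_le_sum (f := w) (fun _ _ => Nat.zero_le _) hu
    · have key : ∀ v, Relation.ReflTransGen (fun a b => A a b ∧ a ∈ S ∧ b ∈ S) v t →
          (v ∈ S.erase u ∧
            Relation.ReflTransGen (fun a b => A a b ∧ a ∈ S.erase u ∧ b ∈ S.erase u) v t) ∨
          ∃ v', A u v' ∧ v' ∈ S.erase u ∧
            Relation.ReflTransGen (fun a b => A a b ∧ a ∈ S.erase u ∧ b ∈ S.erase u) v' t := by
        intro v hv
        induction hv using Relation.ReflTransGen.head_induction_on with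
        | refl => exact Or.inl ⟨Finset.mem_erase.2 ⟨Ne.symm hut, ht⟩, .refl⟩
        | head h1 h2 ih2 =>
          rename_i a c
          rcases ih2 with ⟨hc1, hc2⟩ | h3
          · by_cases hau : a = u
            · subst hau
              exact Or.inr ⟨c, h1.1, hc1, hc2⟩
            · have ha : a ∈ S.erase u := Finset.mem_erase.2 ⟨hau, h1.2.1⟩
              exact Or.inl ⟨ha, .head ⟨h1.1, ha, hc1⟩ hc2⟩
          · exact Or.inr h3
      have : ∃ v', A u v' ∧ v' ∈ S.erase u ∧
            Relation.ReflTransGen (fun a b => A a b ∧ a ∈ S.erase u ∧ b ∈ S.erase u) v' t := by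
        rcases key u h with h3 | h3
        · simp at h3
        · exact h3
      obtain ⟨v', h1, h2, h3⟩ := this
      obtain ⟨m, hm, hle⟩ := ih (S.erase u) v' (by rw [Finset.card_erase_of_mem hu]; omega) h2
        (Finset.mem_erase.2 ⟨Ne.symm hut, ht⟩) h3
      refine ⟨w u + m, (WWalk.of_rel h1).trans hm, ?_⟩
      rw [← Finset.add_sum_erase S w hu]
      omega

theorem orbit_inj {α : Type*} (σ : α → α) (hσ : Function.Injective σ) (Z : α → Prop)
    (c d : α) (p q : ℕ) (hc : Z c) (hd : Z d)
    (hp : ∀ i, 0 < i → i < p → ¬ Z (σ^[i] c)) (hq : ∀ i, 0 < i → i < q → ¬ Z (σ^[i] d))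
    (i j : ℕ) (hi : i < p) (hj : j < q) (h : σ^[i] c = σ^[j] d) : i = j ∧ c = d := by
  rcases lt_trichotomy i j with hij | hij | hij
  · exfalso
    have : j = i + (j - i) := by omega
    rw [this, Function.iterate_add_apply] at h
    have h2 := (hσ.iterate i) h
    exact hq (j - i) (by omega) (by omega) (h2 ▸ hc)
  · subst hij
    exact ⟨rfl, (hσ.iterate i) h⟩
  · exfalso
    have : i = j + (i - j) := by omega
    rw [this, Function.iterate_add_apply] at h
    have h2 := (hσ.iterate j) h
    exact hp (i - j) (by omega) (by omega) (h2 ▸ hd)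

/-- From the injection obtained by Hall, two closed walks. -/
theorem two_walks {V : Type*} [Fintype V] [DecidableEq V] (A : V → V → Prop) (w : V → ℕ)
    (S : Finset V) (g : ℕ) (x : V) (hx : x ∈ S)
    (hw : ∀ v, 1 ≤ w v) (hwx : w x = 1)
    (hcl : ∀ u ∈ S, ∀ v, A u v → v ∈ S) (hloop : ¬ A x x)
    (hg : ∀ v ∈ S, ∀ m, 0 < m → WWalk A w v v m → g ≤ m)
    (σ : Option V → Option V) (hσ : Function.Injective σ)
    (hP : ∀ o, (o = σ o ∧ o.getD x ≠ x) ∨ (o.getD x ∈ S ∧ A (o.getD x) ((σ o).getD x))) :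
    2 * g ≤ ∑ v ∈ S, w v + 1 := by
  classical
  have hret : ∀ c : Option V, c.getD x = x → ∃ p, 0 < p ∧ (σ^[p] c).getD x = x := by
    intro c hc
    obtain ⟨n, hn, hn2⟩ := hσ.mem_periodicPts c
    exact ⟨n, hn, by rw [hn2]; exact hc⟩
  have main : ∀ c : Option V, c.getD x = x → ∃ p, 0 < p ∧
      (∀ i, 0 < i → i < p → ¬ (σ^[i] c).getD x = x) ∧
      g ≤ ∑ j ∈ Finset.range p, w ((σ^[j] c).getD x) ∧
      ∀ j, (σ^[j] c).getD x ∈ S := by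
    intro c hc
    have hne : σ c ≠ c := by
      intro h
      rcases hP c with h1 | h1
      · exact h1.2 hc
      · rw [h, hc] at h1; exact hloop h1.2
    have hstep : ∀ i, (σ^[i] c).getD x ∈ S ∧ A ((σ^[i] c).getD x) ((σ^[i+1] c).getD x) := by
      intro i
      rcases hP (σ^[i] c) with h1 | h1
      · exfalso
        have h2 := h1.1
        rw [← Function.iterate_succ_apply' σ, Function.iterate_succ_apply] at h2
        exact hne ((hσ.iterate i) h2).symm
      · rw [Function.iterate_succ_apply']; exact h1
    have hwalk : ∀ i, WWalk A w x ((σ^[i] c).getD x)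
        (∑ j ∈ Finset.range i, w ((σ^[j] c).getD x)) := by
      intro i
      induction i with
      | zero => simp [hc]; exact WWalk.nil
      | succ i ih => rw [Finset.sum_range_succ]; exact ih.snoc (hstep i).2
    refine ⟨Nat.find (hret c hc), (Nat.find_spec (hret c hc)).1, ?_, ?_, fun j => (hstep j).1⟩
    · intro i hi hi2 h
      exact Nat.find_min (hret c hc) hi2 ⟨hi, h⟩
    · have hs := Nat.find_spec (hret c hc)
      have := hwalk (Nat.find (hret c hc))
      rw [hs.2] at this
      refine hg x hx _ ?_ this
      exact Finset.sum_pos (fun j _ => hw _) (by simpa using hs.1.ne')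
  obtain ⟨p, hp0, hp1, hp2, hp3⟩ := main (some x) rfl
  obtain ⟨q, hq0, hq1, hq2, hq3⟩ := main none rfl
  have e1 : ∑ j ∈ Finset.range p, w ((σ^[j] (some x)).getD x) =
      ∑ o ∈ (Finset.range p).image (fun j => σ^[j] (some x)), w (o.getD x) := by
    rw [Finset.sum_image]
    intro i hi j hj h
    exact (orbit_inj σ hσ (fun o => o.getD x = x) _ _ p p rfl rfl hp1 hp1 i j
      (by simpa using hi) (by simpa using hj) h).1
  have e2 : ∑ j ∈ Finset.range q, w ((σ^[j] none).getD x) =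
      ∑ o ∈ (Finset.range q).image (fun j => σ^[j] none), w (o.getD x) := by
    rw [Finset.sum_image]
    intro i hi j hj h
    exact (orbit_inj σ hσ (fun o => o.getD x = x) _ _ q q rfl rfl hq1 hq1 i j
      (by simpa using hi) (by simpa using hj) h).1
  have hdis : Disjoint ((Finset.range p).image (fun j => σ^[j] (some x)))
      ((Finset.range q).image (fun j => σ^[j] none)) := by
    rw [Finset.disjoint_left]
    intro o h1 h2
    simp only [Finset.mem_image, Finset.mem_range] at h1 h2
    obtain ⟨i, hi, rfl⟩ := h1
    obtain ⟨j, hj, h⟩ := h2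
    have := (orbit_inj σ hσ (fun o => o.getD x = x) _ _ p q rfl rfl hp1 hq1 i j hi hj h.symm).2
    simp at this
  have htot : ∑ o ∈ insert none (S.image some), w (o.getD x) = w x + ∑ v ∈ S, w v := by
    rw [Finset.sum_insert (by simp), Finset.sum_image (by intro a _ b _ h; simpa using h)]
    simp
  have hmemb : ∀ o : Option V, o.getD x ∈ S → o ∈ insert none (S.image some) := by
    intro o ho
    cases o with
    | none => simp
    | some v => simpa using ho
  have hsub : ((Finset.range p).image (fun j => σ^[j] (some x))) ∪
      ((Finset.range q).image (fun j => σ^[j] none)) ⊆ insert none (S.image some) := by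
    intro o ho
    apply hmemb
    simp only [Finset.mem_union, Finset.mem_image] at ho
    rcases ho with ⟨j, _, rfl⟩ | ⟨j, _, rfl⟩
    · exact hp3 j
    · exact hq3 j
  have hle := Finset.sum_le_sum_of_subset (f := fun o : Option V => w (o.getD x)) hsub
  rw [Finset.sum_union hdis, htot, ← e1, ← e2] at hle
  omega

/-- A valid separating triple. -/
def Trip {V : Type*} (A : V → V → Prop) (S : Finset V) (x : V) (T : Finset V) (s : V) : Prop :=
  x ∈ S ∧ T ⊆ S ∧ x ∉ T ∧ s ∈ S ∧ s ∉ T ∧ s ≠ x ∧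
  (∀ v, A x v → v ∈ T ∨ v = s) ∧ (∀ u ∈ T, ∀ v, A u v → v ∈ T ∨ v = s)

theorem hall_step {V : Type*} [Fintype V] [DecidableEq V] (A : V → V → Prop) (w : V → ℕ)
    (S : Finset V) (g : ℕ) (x : V) (hx : x ∈ S)
    (hw : ∀ v, 1 ≤ w v) (hwx : w x = 1)
    (hcl : ∀ u ∈ S, ∀ v, A u v → v ∈ S) (hloop : ¬ A x x)
    (hout : ∃ v, A x v)
    (hg : ∀ v ∈ S, ∀ m, 0 < m → WWalk A w v v m → g ≤ m)
    (hstr : ∀ S' ⊆ S, S'.Nonempty → (∀ u ∈ S', ∀ v, A u v → v ∈ S') → S' = S) :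
    2 * g ≤ ∑ v ∈ S, w v + 1 ∨ ∃ T s, Trip A S x T s := by
  classical
  let P : Option V → Option V → Prop := fun o o' =>
    (o = o' ∧ o.getD x ≠ x) ∨ (o.getD x ∈ S ∧ A (o.getD x) (o'.getD x))
  let t : Option V → Finset (Option V) := fun o => Finset.univ.filter (P o)
  by_cases hall : ∀ U : Finset (Option V), U.card ≤ (U.biUnion t).card
  · left
    obtain ⟨σ, hσ, hσ2⟩ := (Finset.all_card_le_biUnion_card_iff_exists_injective t).1 hall
    exact two_walks A w S g x hx hw hwx hcl hloop hg σ hσ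
      (fun o => by simpa [t, P] using hσ2 o)
  · right
    push Not at hall
    obtain ⟨U, hU⟩ := hall
    set N := U.biUnion t with hN
    have memN : ∀ o', o' ∈ N ↔ ∃ o ∈ U, P o o' := by
      intro o'; simp [hN, t]
    have hgx : ∀ o : Option V, o.getD x = x → o = some x ∨ o = none := by
      intro o ho
      cases o with
      | none => simp
      | some v => left; simpa using ho
    have hself : ∀ o ∈ U, o.getD x ≠ x → o ∈ N := fun o ho h =>
      (memN o).2 ⟨o, ho, Or.inl ⟨rfl, h⟩⟩
    have hnox : ∀ o ∈ N, o.getD x ≠ x := by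
      intro o ho hox
      have hall2 : ∀ o2 : Option V, o2.getD x = x → o2 ∈ N := by
        intro o2 ho2
        obtain ⟨o1, h1, h2⟩ := (memN o).1 ho
        refine (memN o2).2 ⟨o1, h1, ?_⟩
        rcases h2 with h2 | h2
        · exact absurd (h2.1 ▸ hox) h2.2
        · right; rw [ho2]; rw [hox] at h2; exact h2
      have : U ⊆ N := by
        intro o3 h3
        by_cases h4 : o3.getD x = x
        · exact hall2 o3 h4
        · exact hself o3 h3 h4
      exact absurd (Finset.card_le_card this) (by omega)
    set U0 := U.filter (fun o => o.getD x ≠ x) with hU0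
    have hU0N : U0 ⊆ N := by
      intro o ho
      simp only [hU0, Finset.mem_filter] at ho
      exact hself o ho.1 ho.2
    have hex : ∃ o ∈ U, o.getD x = x := by
      by_contra hcon
      push Not at hcon
      have : U ⊆ N := fun o ho => hself o ho (hcon o ho)
      exact absurd (Finset.card_le_card this) (by omega)
    obtain ⟨ox, hox, hoxx⟩ := hex
    have hxN : ∀ v, A x v → some v ∈ N := by
      intro v hv
      refine (memN _).2 ⟨ox, hox, Or.inr ?_⟩
      rw [hoxx]; exact ⟨hx, hv⟩
    have hcard : U.card ≤ U0.card + 2 := by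
      have h1 := Finset.card_filter_add_card_filter_not (s := U) (fun o => o.getD x ≠ x)
      have h2 : (U.filter (fun o => ¬ o.getD x ≠ x)) ⊆ {some x, none} := by
        intro o ho
        simp only [Finset.mem_filter, not_not] at ho
        simpa using hgx o ho.2
      have h3 := Finset.card_le_card h2
      rw [← hU0] at h1
      have h4 : ({some x, none} : Finset (Option V)).card ≤ 2 := Finset.card_le_two
      omega
    have hone : (N \ U0).card ≤ 1 := by
      rw [Finset.card_sdiff_of_subset hU0N]; omega
    rw [Finset.card_le_one] at hone
    let T : Finset V := S.filter (fun v => some v ∈ U0)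
    have hTN : ∀ u ∈ T, ∀ v, A u v → some v ∈ N := by
      intro u hu v hv
      simp only [T, hU0, Finset.mem_filter] at hu
      exact (memN _).2 ⟨some u, hu.2.1, Or.inr ⟨hu.1, hv⟩⟩
    have hxT : x ∉ T := by simp [T, hU0]
    have hTS : T ⊆ S := Finset.filter_subset _ _
    have hsdiff : ∀ v ∈ S, some v ∈ N → v ∉ T → some v ∈ N \ U0 := by
      intro v hv h1 h2
      refine Finset.mem_sdiff.2 ⟨h1, fun h3 => h2 ?_⟩
      exact Finset.mem_filter.2 ⟨hv, h3⟩
    have hexs : ∃ s ∈ S, some s ∈ N ∧ s ∉ T := by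
      by_contra hcon
      push Not at hcon
      obtain ⟨v, hv⟩ := hout
      have := hstr T hTS ⟨v, hcon v (hcl x hx v hv) (hxN v hv)⟩
        (fun u hu v hv => hcon v (hcl u (hTS hu) v hv) (hTN u hu v hv))
      exact hxT (this ▸ hx)
    obtain ⟨s, hsS, hsN, hsT⟩ := hexs
    have hs := hsdiff s hsS hsN hsT
    have huniq : ∀ v ∈ S, some v ∈ N → v ∈ T ∨ v = s := by
      intro v hv h1
      by_cases h2 : v ∈ T
      · exact Or.inl h2
      · right
        have := hone _ (hsdiff v hv h1 h2) _ hs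
        simpa using this
    refine ⟨T, s, hx, hTS, hxT, hsS, hsT, ?_, ?_, ?_⟩
    · intro h; subst h; exact hnox _ hsN rfl
    · intro v hv; exact huniq v (hcl x hx v hv) (hxN v hv)
    · intro u hu v hv; exact huniq v (hcl u (hTS hu) v hv) (hTN u hu v hv)

theorem lift_walk {V : Type*} [DecidableEq V] (A : V → V → Prop) (w : V → ℕ) (T : Finset V)
    (x s : V) (hsT : s ∉ T) (k0 : ℕ) (hk : WWalk A w s x k0) {u v : V} {m : ℕ}
    (h : WWalk (fun u v => (u ∈ T ∧ A u v) ∨ (u = s ∧ v ∈ T ∧ A x v))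
      (Function.update w s (k0 + w x)) u v m) : WWalk A w u v m := by
  induction h with
  | nil => exact .nil
  | snoc _ h ih =>
    rename_i b c m' _
    rcases h with h | h
    · have : b ≠ s := fun e => hsT (e ▸ h.1)
      rw [Function.update_of_ne this]
      exact ih.snoc h.2
    · obtain ⟨rfl, h1, h2⟩ := h
      rw [Function.update_self]
      exact ih.trans (hk.snoc h2)

def Cond {V : Type*} (g : ℕ) (S : Finset V) (A : V → V → Prop) (w : V → ℕ) (z : V) : Prop :=
  z ∈ S ∧ (∀ v, 1 ≤ w v) ∧ (∀ v ∈ S, v ≠ z → w v = 1) ∧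
  (∀ u ∈ S, ∀ v, A u v → v ∈ S) ∧ (∀ u ∈ S, ¬ A u u) ∧
  (∃ v, A z v) ∧ (∀ u ∈ S, u ≠ z → ∃ v1 v2, v1 ≠ v2 ∧ A u v1 ∧ A u v2) ∧
  (∀ v ∈ S, ∀ m, 0 < m → WWalk A w v v m → g ≤ m)

theorem core {V : Type*} [Fintype V] [DecidableEq V] (g : ℕ) :
    ∀ (n : ℕ) (S : Finset V) (A : V → V → Prop) (w : V → ℕ) (z : V), S.card = n →
      Cond g S A w z → 2 * g ≤ ∑ v ∈ S, w v + 1 := by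
  classical
  intro n
  induction n using Nat.strong_induction_on with
  | _ n ih =>
  intro S A w z hn hC
  obtain ⟨hz, hw, hw1, hcl, hloop, hzo, hout, hg⟩ := hC
  by_cases hstr : ∀ S' ⊆ S, S'.Nonempty → (∀ u ∈ S', ∀ v, A u v → v ∈ S') → S' = S
  swap
  · push Not at hstr
    obtain ⟨S', hS', hne, hcl', hneq⟩ := hstr
    have hlt : S'.card < n := by
      rw [← hn]; exact Finset.card_lt_card (hS'.ssubset_of_ne hneq)
    have hle : ∑ v ∈ S', w v ≤ ∑ v ∈ S, w v := Finset.sum_le_sum_of_subset hS'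
    have : ∃ z', Cond g S' A w z' := by
      by_cases hzS : z ∈ S'
      · exact ⟨z, hzS, hw, fun v hv => hw1 v (hS' hv), hcl', fun u hu => hloop u (hS' hu), hzo,
          fun u hu => hout u (hS' hu), fun v hv => hg v (hS' hv)⟩
      · obtain ⟨z', hz'⟩ := hne
        have hnz : ∀ u ∈ S', u ≠ z := fun u hu e => hzS (e ▸ hu)
        obtain ⟨v1, _, _, h1, _⟩ := hout z' (hS' hz') (hnz _ hz')
        exact ⟨z', hz', hw, fun v hv _ => hw1 v (hS' hv) (hnz v hv), hcl',
          fun u hu => hloop u (hS' hu), ⟨v1, h1⟩,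
          fun u hu _ => hout u (hS' hu) (hnz u hu), fun v hv => hg v (hS' hv)⟩
    obtain ⟨z', hz'⟩ := this
    have := ih _ hlt S' A w z' rfl hz'
    omega
  -- reduction when z ∉ T
  have red : ∀ x T s, x ≠ z → Trip A S x T s → z ∉ T → 2 * g ≤ ∑ v ∈ S, w v + 1 := by
    intro x T s hxz hT hzT
    obtain ⟨hxS, hTS, hxT, hsS, hsT, hsx, hxo, hTo⟩ := hT
    obtain ⟨v1, v2, hv12, hv1, hv2⟩ := hout x hxS hxz
    have hr : ∃ r ∈ T, A x r := by
      rcases hxo v1 hv1 with h | h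
      · exact ⟨v1, h, hv1⟩
      · rcases hxo v2 hv2 with h' | h'
        · exact ⟨v2, h', hv2⟩
        · exact absurd (h.trans h'.symm) hv12
    obtain ⟨r, hrT, hr⟩ := hr
    -- reachability
    have hreach : Relation.ReflTransGen (fun a b => A a b ∧ a ∈ S ∧ b ∈ S) s x := by
      let R := S.filter (fun v => Relation.ReflTransGen (fun a b => A a b ∧ a ∈ S ∧ b ∈ S) s v)
      have hR : R = S := by
        apply hstr R (Finset.filter_subset _ _) ⟨s, Finset.mem_filter.2 ⟨hsS, .refl⟩⟩
        intro u hu v hv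
        obtain ⟨h1, h2⟩ := Finset.mem_filter.1 hu
        exact Finset.mem_filter.2 ⟨hcl u h1 v hv, h2.tail ⟨hv, h1, hcl u h1 v hv⟩⟩
      have : x ∈ R := hR ▸ hxS
      exact (Finset.mem_filter.1 this).2
    have key : ∀ v, Relation.ReflTransGen (fun a b => A a b ∧ a ∈ S ∧ b ∈ S) v x →
        (v ∈ S \ T ∧
          Relation.ReflTransGen (fun a b => A a b ∧ a ∈ S \ T ∧ b ∈ S \ T) v x) ∨
          Relation.ReflTransGen (fun a b => A a b ∧ a ∈ S \ T ∧ b ∈ S \ T) s x := by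
      intro v hv
      induction hv using Relation.ReflTransGen.head_induction_on with
      | refl => exact Or.inl ⟨Finset.mem_sdiff.2 ⟨hxS, hxT⟩, .refl⟩
      | head h1 h2 ih2 =>
        rename_i a c
        rcases ih2 with ⟨hc1, hc2⟩ | h3
        · by_cases ha : a ∈ T
          · rcases hTo a ha c h1.1 with h | h
            · exact absurd h (Finset.mem_sdiff.1 hc1).2
            · subst h; exact Or.inr hc2
          · have ha' : a ∈ S \ T := Finset.mem_sdiff.2 ⟨h1.2.1, ha⟩
            exact Or.inl ⟨ha', .head ⟨h1.1, ha', hc1⟩ hc2⟩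
        · exact Or.inr h3
    have hreach2 : Relation.ReflTransGen (fun a b => A a b ∧ a ∈ S \ T ∧ b ∈ S \ T) s x := by
      rcases key s hreach with h | h
      · exact h.2
      · exact h
    obtain ⟨k0, hk0, hk1⟩ := path_bound A w x _ (S \ T) s rfl
      (Finset.mem_sdiff.2 ⟨hsS, hsT⟩) (Finset.mem_sdiff.2 ⟨hxS, hxT⟩) hreach2
    have hsum := Finset.sum_sdiff (f := w) hTS
    have hsum2 : ∑ v ∈ insert s T, Function.update w s (k0 + w x) v
        = (k0 + w x) + ∑ v ∈ T, w v := by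
      rw [Finset.sum_insert hsT, Function.update_self]
      congr 1
      apply Finset.sum_congr rfl
      intro v hv
      have hvs : v ≠ s := fun e => hsT (e ▸ hv)
      exact Function.update_of_ne hvs _ _
    have hlt : (insert s T).card < n := by
      rw [← hn]
      apply Finset.card_lt_card
      refine ⟨Finset.insert_subset hsS hTS, fun h => ?_⟩
      have := h hxS
      rw [Finset.mem_insert] at this
      rcases this with h | h
      · exact hsx h.symm
      · exact hxT h
    have := ih _ hlt (insert s T)
      (fun u v => (u ∈ T ∧ A u v) ∨ (u = s ∧ v ∈ T ∧ A x v))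
      (Function.update w s (k0 + w x)) s rfl ?_
    · omega
    refine ⟨Finset.mem_insert_self _ _, ?_, ?_, ?_, ?_, ⟨r, Or.inr ⟨rfl, hrT, hr⟩⟩, ?_, ?_⟩
    · intro v
      by_cases hv : v = s
      · subst hv; rw [Function.update_self]; have := hw x; omega
      · rw [Function.update_of_ne hv]; exact hw v
    · intro v hv hvs
      rw [Function.update_of_ne hvs]
      have hvT : v ∈ T := (Finset.mem_insert.1 hv).resolve_left hvs
      exact hw1 v (hTS hvT) (fun e => hzT (e ▸ hvT))
    · intro u hu v huv
      rw [Finset.mem_insert]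
      rcases huv with h | h
      · exact (hTo u h.1 v h.2).symm
      · exact Or.inr h.2.1
    · intro u hu h
      rcases h with h | h
      · exact hloop u (hTS h.1) h.2
      · exact hsT (h.1 ▸ h.2.1)
    · intro u hu hus
      have huT : u ∈ T := (Finset.mem_insert.1 hu).resolve_left hus
      obtain ⟨a, b, hab, ha, hb⟩ := hout u (hTS huT) (fun e => hzT (e ▸ huT))
      exact ⟨a, b, hab, Or.inl ⟨huT, ha⟩, Or.inl ⟨huT, hb⟩⟩
    · intro v hv m hm hwk
      exact hg v (Finset.insert_subset hsS hTS hv) m hm (lift_walk A w T x s hsT k0 hk0 hwk)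
  have hall : ∀ x ∈ S, x ≠ z → 2 * g ≤ ∑ v ∈ S, w v + 1 ∨ ∃ T s, Trip A S x T s := by
    intro x hx hxz
    obtain ⟨v1, _, _, h1, _⟩ := hout x hx hxz
    exact hall_step A w S g x hx hw (hw1 x hx hxz) hcl (hloop x hx) ⟨v1, h1⟩ hg hstr
  have noTrip : ∀ (c : ℕ) x T s, T.card = c → x ≠ z → Trip A S x T s →
      2 * g ≤ ∑ v ∈ S, w v + 1 := by
    intro c
    induction c using Nat.strong_induction_on with
    | _ c ihc =>
    intro x T s hc hxz hT
    by_cases hzT : z ∈ T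
    swap
    · exact red x T s hxz hT hzT
    have hT' := hT
    obtain ⟨hxS, hTS, hxT, hsS, hsT, hsx, hxo, hTo⟩ := hT
    have hsz : s ≠ z := fun e => hsT (e ▸ hzT)
    rcases hall s hsS hsz with h | ⟨T2, s2, hT2⟩
    · exact h
    by_cases hzT2 : z ∈ T2
    swap
    · exact red s T2 s2 hsz hT2 hzT2
    obtain ⟨-, hTS2, hsT2, hsS2, hs2T2, hs2s, hso, hTo2⟩ := hT2
    have hs2T : s2 ∈ T := by
      by_contra hcon
      have := hstr (T ∩ T2) (Finset.inter_subset_left.trans hTS)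
        ⟨z, Finset.mem_inter.2 ⟨hzT, hzT2⟩⟩ (by
          intro u hu v hv
          obtain ⟨h1, h2⟩ := Finset.mem_inter.1 hu
          have := hTo u h1 v hv
          have := hTo2 u h2 v hv
          rw [Finset.mem_inter]
          grind)
      have h5 : x ∈ T ∩ T2 := this ▸ hxS
      exact hxT (Finset.mem_inter.1 h5).1
    have hxT2 : x ∈ T2 := by
      by_contra hcon
      have := hstr (insert s (T ∪ T2)) (by
          intro v hv
          simp only [Finset.mem_insert, Finset.mem_union] at hv
          rcases hv with rfl | h | h
          · exact hsS
          · exact hTS h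
          · exact hTS2 h) ⟨s, by simp⟩ (by
          intro u hu v hv
          simp only [Finset.mem_insert, Finset.mem_union] at hu ⊢
          rcases hu with rfl | h | h
          · have := hso v hv; grind
          · have := hTo u h v hv; grind
          · have := hTo2 u h v hv; grind)
      have h5 : x ∈ insert s (T ∪ T2) := this ▸ hxS
      simp only [Finset.mem_insert, Finset.mem_union] at h5
      rcases h5 with h | h | h
      · exact hsx h.symm
      · exact hxT h
      · exact hcon h
    refine ihc (T ∩ T2).card ?_ x (T ∩ T2) s2 rfl hxz ?_
    · rw [← hc]
      apply Finset.card_lt_card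
      refine ⟨Finset.inter_subset_left, fun h => ?_⟩
      exact hs2T2 (Finset.mem_inter.1 (h hs2T)).2
    · refine ⟨hxS, Finset.inter_subset_left.trans hTS, ?_, hsS2, ?_, ?_, ?_, ?_⟩
      · simp [hxT]
      · simp [hs2T2]
      · intro e; exact hs2T2 (e ▸ hxT2)
      · intro v hv
        have := hxo v hv
        have := hTo2 x hxT2 v hv
        rw [Finset.mem_inter]
        grind
      · intro u hu v hv
        obtain ⟨h1, h2⟩ := Finset.mem_inter.1 hu
        have := hTo u h1 v hv
        have := hTo2 u h2 v hv
        rw [Finset.mem_inter]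
        grind
  obtain ⟨x, hx⟩ := hzo
  have hxS := hcl z hz x hx
  have hxz : x ≠ z := fun e => hloop z hz (e ▸ hx)
  rcases hall x hxS hxz with h | ⟨T, s, hT⟩
  · exact h
  · exact noTrip _ x T s rfl hxz hT

theorem walk_fun {V : Type*} {A : V → V → Prop} {u v : V} {m : ℕ}
    (h : WWalk A (fun _ => 1) u v m) :
    ∃ f : ℕ → V, f 0 = u ∧ f m = v ∧ ∀ i < m, A (f i) (f (i + 1)) := by
  induction h with
  | nil => exact ⟨fun _ => u, rfl, rfl, by simp⟩
  | snoc _ h ih =>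
    rename_i b c m' _
    obtain ⟨f, h0, h1, h2⟩ := ih
    refine ⟨fun i => if i ≤ m' then f i else c, by simp [h0], by simp, ?_⟩
    intro i hi
    rcases Nat.lt_or_ge i m' with h3 | h3
    · simp [h3.le, Nat.succ_le_of_lt h3, h2 i h3]
    · have : i = m' := by omega
      subst this
      simp [h1, h]

theorem fun_walk {V : Type*} {A : V → V → Prop} (f : ℕ → V) (i : ℕ) :
    ∀ d, (∀ j < i + d, A (f j) (f (j + 1))) → WWalk A (fun _ => 1) (f i) (f (i + d)) d := by
  intro d
  induction d with
  | zero => intro _; exact .nil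
  | succ d ih =>
    intro h
    exact (ih (fun j hj => h j (by omega))).snoc (h (i + d) (by omega))

/-- Shen's theorem, case `t = 0`: a loopless digraph of order `n` in which every
vertex has out-degree at least `2` contains a directed cycle of length at most
`⌈n/2⌉`. -/
theorem stmt_5 {V : Type*} [Fintype V] [Nonempty V] (A : V → V → Prop)
    (hloop : ∀ v, ¬ A v v)
    (hdeg : ∀ v : V, 2 ≤ Nat.card {w : V // A v w}) :
    ∃ (m : ℕ) (c : ZMod m → V), IsCycleOn A m c ∧ m ≤ (Fintype.card V + 1) / 2 := by
  classical
  have hout : ∀ u, ∃ v1 v2, v1 ≠ v2 ∧ A u v1 ∧ A u v2 := by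
    intro u
    have h := hdeg u
    rw [Nat.card_eq_fintype_card] at h
    obtain ⟨a, b, hab⟩ := Fintype.one_lt_card_iff.1 (show 1 < _ from h)
    exact ⟨a, b, fun e => hab (Subtype.ext e), a.2, b.2⟩
  obtain ⟨z⟩ := ‹Nonempty V›
  have Q : ∀ g, (∀ v m, 0 < m → WWalk A (fun _ => 1) v v m → g ≤ m) →
      2 * g ≤ Fintype.card V + 1 := by
    intro g hg
    obtain ⟨a, _, _, ha, _⟩ := hout z
    have := core g _ Finset.univ A (fun _ => 1) z rfl ⟨Finset.mem_univ _, fun _ => le_rfl,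
      fun _ _ _ => rfl, fun _ _ _ _ => Finset.mem_univ _, fun u _ => hloop u, ⟨a, ha⟩,
      fun u _ _ => hout u, fun v _ => hg v⟩
    simpa using this
  have hex : ∃ m, 0 < m ∧ ∃ v, WWalk A (fun _ => 1) v v m := by
    by_contra hcon
    push Not at hcon
    have := Q (Fintype.card V + 1) (fun v m hm h => absurd h (hcon m hm v))
    omega
  have hmin := fun m => Nat.find_min (H := hex) (m := m)
  have hspec := Nat.find_spec hex
  generalize Nat.find hex = g at hmin hspec
  have hb := Q g (fun v m hm h => by
    by_contra hlt
    exact hmin m (by omega) ⟨hm, v, h⟩)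
  obtain ⟨hg0, v, hv⟩ := hspec
  obtain ⟨f, h0, h1, h2⟩ := walk_fun hv
  have hg1 : g ≠ 1 := by
    rintro rfl
    have := h2 0 (by omega)
    rw [h0, zero_add, h1] at this
    exact hloop v this
  have hinj : ∀ i j, i < j → j < g → f i ≠ f j := by
    intro i j hij hj he
    have := fun_walk (A := A) f i (j - i) (fun k hk => h2 k (by omega))
    rw [show i + (j - i) = j by omega, ← he] at this
    exact hmin (j - i) (by omega) ⟨by omega, _, this⟩
  haveI : NeZero g := ⟨hg0.ne'⟩
  refine ⟨g, fun i => f i.val, ⟨by omega, ?_, ?_⟩, by omega⟩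
  · intro i j he
    have hi := ZMod.val_lt i
    have hj := ZMod.val_lt j
    apply ZMod.val_injective
    rcases lt_trichotomy i.val j.val with h | h | h
    · exact absurd he (hinj _ _ h hj)
    · exact h
    · exact absurd he.symm (hinj _ _ h hi)
  · intro i
    have hi := ZMod.val_lt i
    have hA := h2 _ hi
    haveI : Fact (1 < g) := ⟨by omega⟩
    have hval : (i + 1).val = (i.val + 1) % g := by rw [ZMod.val_add, ZMod.val_one]
    show A (f i.val) (f (i + 1).val)
    rw [hval]
    by_cases h : i.val + 1 < g
    · rw [Nat.mod_eq_of_lt h]; exact hA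
    · have : i.val + 1 = g := by omega
      rw [this, Nat.mod_self, h0, ← h1]
      rw [this] at hA
      exact hA
end

section
/- Let D be a digraph such that every vertex of D has in-degree at least 1 and out-degree at least 1, and let S ⊆ V(D) with |S| = n and t = |{u ∈ S : exactly one arc of the 'S-path digraph' leaves u}|. If t ≤ |S| − 2k for some k ≥ 1, and every vertex of the S-path digraph has out-degree at least 1, then the S-path digraph contains a directed cycle avoiding at least k vertices of S. (Formally: any digraph H on vertex set S with δ⁺(H) ≥ 1, in which the number t of vertices of out-degree exactly 1 satisfies t ≤ |S| − 2k, contains a directed cycle of length at most |S| − k.) -/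
def Wk {V : Type*} (R : V → V → Prop) : ℕ → V → V → Prop
  | 0, x, y => x = y
  | n + 1, x, y => ∃ z, R x z ∧ Wk R n z y

theorem Wk.append {V : Type*} {R : V → V → Prop} {a b : ℕ} {x y z : V}
    (h : Wk R a x y) (h' : Wk R b y z) : Wk R (a + b) x z := by
  induction a generalizing x with
  | zero => cases h; simpa using h'
  | succ n ih =>
    obtain ⟨w, hw, h⟩ := h
    have := ih h
    rw [show n + 1 + b = (n + b) + 1 by omega]
    exact ⟨w, hw, this⟩

theorem Wk.mono {V : Type*} {R R' : V → V → Prop} (hR : ∀ x y, R x y → R' x y)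
    {a : ℕ} {x y : V} (h : Wk R a x y) : Wk R' a x y := by
  induction a generalizing x with
  | zero => exact h
  | succ n ih =>
    obtain ⟨w, hw, h⟩ := h
    exact ⟨w, hR _ _ hw, ih h⟩

theorem Wk.fn {V : Type*} {R : V → V → Prop} {a : ℕ} {x y : V} (h : Wk R a x y) :
    ∃ f : ℕ → V, f 0 = x ∧ f a = y ∧ ∀ i < a, R (f i) (f (i + 1)) := by
  induction a generalizing x with
  | zero => exact ⟨fun _ => x, rfl, h, by omega⟩
  | succ n ih =>
    obtain ⟨w, hw, h⟩ := h
    obtain ⟨f, h0, h1, h2⟩ := ih h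
    refine ⟨fun i => if i = 0 then x else f (i - 1), by simp, by simpa using h1, ?_⟩
    intro i hi
    rcases i with _ | i
    · simpa [h0] using hw
    · simpa using h2 i (by omega)

theorem Wk.of_fn {V : Type*} {R : V → V → Prop} (f : ℕ → V) (i a : ℕ)
    (h : ∀ j, i ≤ j → j < i + a → R (f j) (f (j + 1))) : Wk R a (f i) (f (i + a)) := by
  induction a generalizing i with
  | zero => rfl
  | succ n ih =>
    refine ⟨f (i + 1), h i le_rfl (by omega), ?_⟩
    have := ih (i + 1) (fun j h1 h2 => h j (by omega) (by omega))
    rwa [show i + 1 + n = i + (n + 1) by omega] at this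

theorem exists_cycle {V : Type*} (A : V → V → Prop) (hloop : ∀ v, ¬ A v v) (m : ℕ)
    (hm : 1 ≤ m) (x : V) (h : Wk A m x x) :
    ∃ (m' : ℕ) (c : ZMod m' → V), IsCycleOn A m' c ∧ m' ≤ m := by
  classical
  have hex : ∃ m, 1 ≤ m ∧ ∃ x, Wk A m x x := ⟨m, hm, x, h⟩
  obtain ⟨h1, y, hy⟩ := Nat.find_spec hex
  have hmin : ∀ j, 1 ≤ j → j < Nat.find hex → ∀ x, ¬ Wk A j x x := by
    intro j hj hlt x hx
    exact Nat.find_min hex hlt ⟨hj, x, hx⟩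
  have hle : Nat.find hex ≤ m := Nat.find_min' hex ⟨hm, x, h⟩
  generalize Nat.find hex = k at *
  obtain ⟨f, f0, fk, hf⟩ := hy.fn
  have h2 : 2 ≤ k := by
    by_contra hlt
    have : k = 1 := by omega
    subst this
    have := hf 0 (by omega)
    rw [f0, zero_add, fk] at this
    exact hloop _ this
  have hinj : ∀ i j, i < j → j < k → f i ≠ f j := by
    intro i j hij hj he
    have := Wk.of_fn (R := A) f i (j - i) (fun l h1 h2 => hf l (by omega))
    rw [show i + (j - i) = j by omega, ← he] at this
    exact hmin (j - i) (by omega) (by omega) _ this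
  obtain ⟨n, rfl⟩ : ∃ n, k = n + 1 := ⟨k - 1, by omega⟩
  have hA : ∀ i j : Fin (n + 1), f i.val = f j.val → i = j := by
    intro i j hij
    rcases lt_trichotomy i j with hl | hl | hl
    · exact absurd hij (hinj _ _ hl j.2)
    · exact hl
    · exact absurd hij.symm (hinj _ _ hl i.2)
  have hB : ∀ i : Fin (n + 1), A (f i.val) (f (i + 1).val) := by
    intro i
    have hi := hf i.val i.2
    rw [Fin.val_add_one]
    split_ifs with hlast
    · rw [hlast] at hi ⊢
      simp only [Fin.val_last] at hi ⊢
      rw [fk] at hi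
      rwa [f0]
    · exact hi
  exact ⟨n + 1, fun i : Fin (n + 1) => f i.val, ⟨h2, fun i j h => hA i j h, fun i => hB i⟩, hle⟩

/-- relation from an out-neighbourhood function -/
def Ro {V : Type*} (N : V → Finset V) (x y : V) : Prop := y ∈ N x

theorem closure_lemma {V : Type*} [DecidableEq V] (S : Finset V) (N : V → Finset V)
    (h1 : ∀ x ∈ S, 1 ≤ (N x).card) (h2 : ∀ x ∈ S, (N x).card ≤ 2) (v : V) (hv : v ∈ S) :
    ∃ (T : Finset V) (e c : ℕ), v ∈ T ∧ T ⊆ S ∧ 2 * e ≤ c ∧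
      c + ∑ x ∈ T.erase v, (N x).card = 3 * (T.erase v).card ∧
      (∀ x ∈ T, ∃ d ≤ e, Wk (Ro N) d x v) ∧
      (∀ Q ⊆ T, 1 ≤ Q.card → Q.card ≤ 2 → ∃ p ∈ Q, ∃ d, Wk (Ro N) d p v ∧
        2 * (d + 1) + Q.card ≤ c + 3) ∧
      (∀ x ∈ S, x ∉ T → ¬ N x ⊆ T) := by
  classical
  let P : Finset V → Prop := fun T => v ∈ T ∧ T ⊆ S ∧ ∃ e c : ℕ,
    c + ∑ x ∈ T.erase v, (N x).card = 3 * (T.erase v).card ∧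
    (∀ x ∈ T, ∃ d ≤ e, Wk (Ro N) d x v) ∧
    (2 * e + 1 ≤ c ∨ (2 * e ≤ c ∧ ∃ z, ∀ x ∈ T, x ≠ z → ∃ d, d + 1 ≤ e ∧ Wk (Ro N) d x v))
  have hne : (S.powerset.filter P).Nonempty := by
    refine ⟨{v}, ?_⟩
    simp only [Finset.mem_filter, Finset.mem_powerset, Finset.singleton_subset_iff]
    refine ⟨hv, by simp, by simpa using hv, 0, 0, by simp, ?_, Or.inr ⟨by omega, v, ?_⟩⟩
    · intro x hx
      exact ⟨0, le_rfl, Finset.mem_singleton.1 hx⟩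
    · intro x hx hx'
      simp at hx
      exact absurd hx hx'
  obtain ⟨T, hT, hmax⟩ := Finset.exists_max_image _ Finset.card hne
  obtain ⟨-, hvT, hTS, e, c, hc, hd, hcase⟩ := Finset.mem_filter.1 hT
  have key : ∀ Q ⊆ T, 1 ≤ Q.card → Q.card ≤ 2 → ∃ p ∈ Q, ∃ d, d ≤ e ∧ Wk (Ro N) d p v ∧
        2 * (d + 1) + Q.card ≤ c + 3 := by
    intro Q hQ hQ1 hQ2
    obtain ⟨p, hp⟩ := Finset.card_pos.1 hQ1
    rcases hcase with hc1 | ⟨hc1, z, hz⟩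
    · obtain ⟨d, hde, hw⟩ := hd p (hQ hp)
      exact ⟨p, hp, d, hde, hw, by omega⟩
    · by_cases hQc : Q.card = 1
      · obtain ⟨d, hde, hw⟩ := hd p (hQ hp)
        exact ⟨p, hp, d, hde, hw, by omega⟩
      · obtain ⟨q, hq, hqz⟩ := Finset.exists_mem_ne (show 1 < Q.card by omega) z
        obtain ⟨d, hde, hw⟩ := hz q (hQ hq) hqz
        exact ⟨q, hq, d, by omega, hw, by omega⟩
  refine ⟨T, e, c, hvT, hTS, by omega, hc, hd, ?_, ?_⟩
  · intro Q hQ a b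
    obtain ⟨p, hp, d, -, h⟩ := key Q hQ a b
    exact ⟨p, hp, d, h⟩
  · intro x hxS hxT hNx
    obtain ⟨p, hp, d, hde, hw, hb⟩ := key _ hNx (h1 x hxS) (h2 x hxS)
    have hxw : Wk (Ro N) (d + 1) x v := ⟨p, hp, hw⟩
    have hxv : x ≠ v := fun h => hxT (h ▸ hvT)
    have hxE : x ∉ T.erase v := fun h => hxT (Finset.mem_of_mem_erase h)
    have hbig : insert x T ∈ S.powerset.filter P := by
      simp only [Finset.mem_filter, Finset.mem_powerset]
      have hsub : insert x T ⊆ S := Finset.insert_subset hxS hTS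
      refine ⟨hsub, Finset.mem_insert_of_mem hvT, hsub, ?_⟩
      have hx1 := h1 x hxS
      have hx2 := h2 x hxS
      have hsum : (c + 3 - (N x).card) + ∑ y ∈ (insert x T).erase v, (N y).card
          = 3 * ((insert x T).erase v).card := by
        rw [Finset.erase_insert_of_ne hxv, Finset.sum_insert hxE, Finset.card_insert_of_notMem hxE]
        omega
      by_cases hs : 2 * e + 1 ≤ c + 3 - (N x).card ∧ d + 1 ≤ e
      · refine ⟨e, c + 3 - (N x).card, hsum, ?_, Or.inl hs.1⟩
        intro y hy
        rcases Finset.mem_insert.1 hy with rfl | hy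
        · exact ⟨d + 1, hs.2, hxw⟩
        · exact hd y hy
      · have hde' : d = e := by omega
        subst hde'
        refine ⟨d + 1, c + 3 - (N x).card, hsum, ?_, Or.inr ⟨by omega, x, ?_⟩⟩
        · intro y hy
          rcases Finset.mem_insert.1 hy with rfl | hy
          · exact ⟨d + 1, le_rfl, hxw⟩
          · obtain ⟨d', h, h'⟩ := hd y hy
            exact ⟨d', by omega, h'⟩
        · intro y hy hyx
          rcases Finset.mem_insert.1 hy with rfl | hy
          · exact absurd rfl hyx
          · obtain ⟨d', h, h'⟩ := hd y hy
            exact ⟨d', by omega, h'⟩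
    have := hmax _ hbig
    rw [Finset.card_insert_of_notMem hxT] at this
    omega

theorem lift_walk_s8 {V : Type*} (R R' : V → V → Prop) (v : V) (T : Finset V)
    (hR : ∀ x y, R' x y → R x y ∨ (y = v ∧ ∃ p ∈ T, R x p)) (m : ℕ) (x y : V)
    (h : Wk R' m x y) : Wk R m x y ∨
      ∃ i, 1 ≤ i ∧ i ≤ m ∧ (∃ p ∈ T, Wk R i x p) ∧ Wk R' (m - i) v y := by
  induction m generalizing x with
  | zero => exact Or.inl h
  | succ n ih =>
    obtain ⟨w, hw, h⟩ := h
    rcases hR _ _ hw with hxw | ⟨rfl, p, hp, hxp⟩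
    · rcases ih w h with h | ⟨i, hi1, hi2, ⟨p, hp, hwp⟩, h'⟩
      · exact Or.inl ⟨w, hxw, h⟩
      · refine Or.inr ⟨i + 1, by omega, by omega, ⟨p, hp, w, hxw, hwp⟩, ?_⟩
        rwa [show n + 1 - (i + 1) = n - i by omega]
    · exact Or.inr ⟨1, le_rfl, by omega, ⟨p, hp, p, hxp, rfl⟩, by simpa using h⟩

theorem lift_closed {V : Type*} (R R' : V → V → Prop) (v : V) (T : Finset V) (e : ℕ)
    (hT : ∀ p ∈ T, ∃ d ≤ e, Wk R d p v)
    (hR : ∀ x y, R' x y → R x y ∨ (y = v ∧ ∃ p ∈ T, R x p)) (m : ℕ) (hm : 1 ≤ m) (x : V)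
    (h : Wk R' m x x) : ∃ m' y, 1 ≤ m' ∧ m' ≤ m + e ∧ Wk R m' y y := by
  rcases lift_walk_s8 R R' v T hR m x x h with h | ⟨i, hi1, hi2, ⟨p, hp, hxp⟩, h⟩
  · exact ⟨m, x, hm, by omega, h⟩
  · obtain ⟨d, hde, hpv⟩ := hT p hp
    rcases lift_walk_s8 R R' v T hR _ _ _ h with h | ⟨j, hj1, hj2, ⟨q, hq, hvq⟩, -⟩
    · exact ⟨_, v, by omega, by omega, (h.append hxp).append hpv⟩
    · obtain ⟨d', hde', hqv⟩ := hT q hq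
      exact ⟨_, v, by omega, by omega, hvq.append hqv⟩

/-- the inductive claim for vertex sets of size `n` -/
def Claim (V : Type*) (n : ℕ) : Prop :=
  ∀ (S : Finset V) (N : V → Finset V), S.card = n → 1 ≤ n → (∀ x ∈ S, N x ⊆ S) →
    (∀ x ∈ S, 1 ≤ (N x).card) → (∀ x ∈ S, (N x).card ≤ 2) →
    ∃ m y, 1 ≤ m ∧ Wk (Ro N) m y y ∧ 2 * m + min (∑ x ∈ S, (N x).card) (2 * n - 1) ≤ 3 * n

theorem del_lemma {V : Type*} [DecidableEq V] (S : Finset V) (N : V → Finset V)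
    (hS : 2 ≤ S.card) (IH : Claim V (S.card - 1)) (hN : ∀ x ∈ S, N x ⊆ S)
    (h2 : ∀ x ∈ S, (N x).card = 2) (y : V) (hy : y ∈ S) (i : ℕ)
    (hi : (S.filter (fun x => y ∈ N x)).card ≤ i) (hi1 : 1 ≤ i) :
    ∃ m z, 1 ≤ m ∧ Wk (Ro (fun x => (N x).erase y)) m z z ∧ 2 * m + 1 ≤ S.card + i := by
  have hcard : (S.erase y).card = S.card - 1 := Finset.card_erase_of_mem hy
  obtain ⟨m, z, hm, hw, hb⟩ := IH (S.erase y) (fun x => (N x).erase y) hcard (by omega)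
    (fun x hx => Finset.erase_subset_erase y (hN x (Finset.mem_of_mem_erase hx)))
    (fun x hx => by
      have := h2 x (Finset.mem_of_mem_erase hx)
      have := Finset.pred_card_le_card_erase (s := N x) (a := y)
      omega)
    (fun x hx => by
      have := h2 x (Finset.mem_of_mem_erase hx)
      have := Finset.card_erase_le (s := N x) (a := y)
      omega)
  refine ⟨m, z, hm, hw, ?_⟩
  have hsum : 2 * (S.erase y).card ≤ ∑ x ∈ S.erase y, ((N x).erase y).card + i := by
    calc 2 * (S.erase y).card = ∑ x ∈ S.erase y, 2 := by simp [mul_comm]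
      _ = ∑ x ∈ S.erase y, (((N x).erase y).card + if y ∈ N x then 1 else 0) := by
          apply Finset.sum_congr rfl
          intro x hx
          have := h2 x (Finset.mem_of_mem_erase hx)
          split_ifs with h
          · rw [Finset.card_erase_of_mem h]; omega
          · rw [Finset.erase_eq_of_notMem h]; omega
      _ = ∑ x ∈ S.erase y, ((N x).erase y).card + ((S.erase y).filter (fun x => y ∈ N x)).card := by
          rw [Finset.sum_add_distrib, Finset.card_filter]
      _ ≤ _ := by
          have : ((S.erase y).filter (fun x => y ∈ N x)).card ≤
            (S.filter (fun x => y ∈ N x)).card :=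
            Finset.card_le_card (Finset.filter_subset_filter _ (Finset.erase_subset _ _))
          omega
  rw [hcard] at hsum
  omega

theorem step_lemma {V : Type*} [DecidableEq V] (n : ℕ) (IH : ∀ k < n, Claim V k)
    (S : Finset V) (N : V → Finset V) (hn : S.card = n) (hN : ∀ x ∈ S, N x ⊆ S)
    (h1 : ∀ x ∈ S, 1 ≤ (N x).card) (h2 : ∀ x ∈ S, (N x).card ≤ 2)
    (he : ∑ x ∈ S, (N x).card < 2 * n) :
    ∃ m y, 1 ≤ m ∧ Wk (Ro N) m y y ∧ 2 * m + ∑ x ∈ S, (N x).card ≤ 3 * n := by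
  obtain ⟨u, hu, hu1⟩ : ∃ u ∈ S, (N u).card = 1 := by
    by_contra hcon
    push Not at hcon
    have : ∑ x ∈ S, 2 ≤ ∑ x ∈ S, (N x).card := Finset.sum_le_sum (fun x hx => by
      have := h1 x hx
      have := hcon x hx
      omega)
    simp at this
    omega
  obtain ⟨v, hv⟩ := Finset.card_eq_one.1 hu1
  have hvS : v ∈ S := hN u hu (by simp [hv])
  by_cases huv : u = v
  · subst huv
    refine ⟨1, u, le_rfl, ⟨u, by simp [Ro, hv], rfl⟩, ?_⟩
    have := Finset.card_pos.2 ⟨u, hu⟩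
    omega
  obtain ⟨T, e, c, hvT, hTS, hec, hc, hd, hQ, hcl⟩ := closure_lemma S N h1 h2 v hvS
  have huT : u ∈ T := by
    by_contra h
    exact hcl u hu h (by simpa [hv] using hvT)
  -- sums
  have hTc : (T.erase v).card + 1 = T.card := Finset.card_erase_add_one hvT
  have hT2 : 1 ≤ (T.erase v).card := Finset.card_pos.2 ⟨u, Finset.mem_erase.2 ⟨huv, huT⟩⟩
  have hTle := Finset.card_le_card hTS
  have hsumT : ∑ x ∈ T.erase v, (N x).card ≤ 2 * (T.erase v).card - 1 := by
    have hue : u ∈ T.erase v := Finset.mem_erase.2 ⟨huv, huT⟩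
    rw [← Finset.add_sum_erase _ _ hue, hu1]
    have h3 : ∑ x ∈ (T.erase v).erase u, (N x).card ≤ ((T.erase v).erase u).card * 2 :=
      Finset.sum_le_card_nsmul _ _ _ (fun x hx => h2 x (hTS (Finset.mem_of_mem_erase
        (Finset.mem_of_mem_erase hx))))
    rw [Finset.card_erase_of_mem hue] at h3
    omega
  have hc2 : 2 ≤ c := by omega
  have hES : T.erase v ⊆ S := (Finset.erase_subset _ _).trans hTS
  have hsplit : ∑ x ∈ S \ T.erase v, (N x).card + ∑ x ∈ T.erase v, (N x).card
      = ∑ x ∈ S, (N x).card := Finset.sum_sdiff hES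
  set S' := S \ T.erase v with hS'
  have hcS' : S'.card + (T.erase v).card = n := by
    rw [hS', Finset.card_sdiff_add_card_eq_card hES, hn]
  have hvS' : v ∈ S' := by simp [hS', hvS]
  have hS'S : S' ⊆ S := Finset.sdiff_subset
  have hS'T : ∀ x ∈ S', x ≠ v → x ∉ T := by
    intro x hx hxv hxT
    simp [hS', hxv, hxT] at hx
  have hsumS' : ∑ x ∈ S', (N x).card ≤ 2 * S'.card := by
    have := Finset.sum_le_card_nsmul S' (fun x => (N x).card) 2 (fun x hx => h2 x (hS'S hx))
    simp only [smul_eq_mul] at this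
    omega
  by_cases hvN : N v ⊆ T
  · obtain ⟨p, hp, d, hw, hb⟩ := hQ (N v) hvN (h1 v hvS) (h2 v hvS)
    refine ⟨d + 1, v, by omega, ⟨p, hp, hw⟩, ?_⟩
    have h3 := Finset.add_sum_erase S' (fun x => (N x).card) hvS'
    have h4 : ∑ x ∈ S'.erase v, (N x).card ≤ (S'.erase v).card * 2 :=
      Finset.sum_le_card_nsmul _ _ _ (fun x hx => h2 x (hS'S (Finset.mem_of_mem_erase hx)))
    have h5 := Finset.card_erase_add_one hvS'
    omega
  have hnot : ∀ x ∈ S', ¬ N x ⊆ T := by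
    intro x hx
    by_cases hxv : x = v
    · rwa [hxv]
    · exact hcl x (hS'S hx) (hS'T x hx hxv)
  let φ : V → V := fun x => if x ∈ T then v else x
  let N' : V → Finset V := fun x => (N x).image φ
  have hN' : ∀ x ∈ S', N' x ⊆ S' := by
    intro x hx y hy
    obtain ⟨p, hp, rfl⟩ := Finset.mem_image.1 hy
    simp only [φ]
    split_ifs with h
    · exact hvS'
    · have := hN x (hS'S hx) hp
      simp [hS', this, h]
  have hcN' : ∀ x ∈ S', (N' x).card = (N x).card := by
    intro x hx
    apply Finset.card_image_of_injOn
    intro p hp q hq hpq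
    by_contra hne
    have hsub : ({p, q} : Finset V) = N x := by
      apply Finset.eq_of_subset_of_card_le
      · intro a ha
        simp at ha
        rcases ha with rfl | rfl <;> assumption
      · rw [Finset.card_pair hne]; exact h2 x (hS'S hx)
    apply hnot x hx
    rw [← hsub]
    simp only [φ] at hpq
    intro a ha
    simp at ha
    split_ifs at hpq with ha1 ha2 ha2
    · rcases ha with rfl | rfl <;> assumption
    · exact absurd (hpq ▸ hvT) ha2
    · exact absurd (hpq ▸ hvT) ha1
    · exact absurd hpq hne
  have hR : ∀ x y, Ro N' x y → Ro N x y ∨ (y = v ∧ ∃ p ∈ T, Ro N x p) := by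
    intro x y hxy
    obtain ⟨p, hp, rfl⟩ := Finset.mem_image.1 hxy
    simp only [φ]
    split_ifs with h
    · exact Or.inr ⟨rfl, p, h, hp⟩
    · exact Or.inl hp
  have hsum' : ∑ x ∈ S', (N' x).card = ∑ x ∈ S', (N x).card := Finset.sum_congr rfl hcN'
  by_cases ht : ∑ x ∈ S', (N x).card < 2 * S'.card
  · obtain ⟨m, y, hm, hw, hb⟩ := IH S'.card (by omega) S' N' rfl
      (Finset.card_pos.2 ⟨v, hvS'⟩) hN'
      (fun x hx => by rw [hcN' x hx]; exact h1 x (hS'S hx))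
      (fun x hx => by rw [hcN' x hx]; exact h2 x (hS'S hx))
    obtain ⟨m', z, hm', hb', hw'⟩ := lift_closed _ _ v T e hd hR m hm y hw
    refine ⟨m', z, hm', hw', ?_⟩
    rw [hsum'] at hb
    omega
  · have heq : ∑ x ∈ S', (N x).card = 2 * S'.card := by omega
    have hall : ∀ x ∈ S', (N' x).card = 2 := by
      intro x hx
      rw [hcN' x hx]
      have h3 := Finset.add_sum_erase S' (fun x => (N x).card) hx
      have h4 : ∑ x ∈ S'.erase x, (N x).card ≤ (S'.erase x).card * 2 :=
        Finset.sum_le_card_nsmul _ _ _ (fun x hx => h2 x (hS'S (Finset.mem_of_mem_erase hx)))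
      have h5 := Finset.card_erase_add_one hx
      have := h2 x (hS'S hx)
      omega
    have hS'2 : 2 ≤ S'.card := by
      have := Finset.card_le_card (hN' v hvS')
      rwa [hall v hvS'] at this
    by_cases hin : (S'.filter (fun x => v ∈ N' x)).card ≤ 2
    · obtain ⟨m, z, hm, hw, hb⟩ := del_lemma S' N' hS'2 (IH _ (by omega)) hN' hall v hvS' 2 hin
        (by omega)
      refine ⟨m, z, hm, hw.mono ?_, by omega⟩
      intro x y hxy
      obtain ⟨hyv, hxy⟩ := Finset.mem_erase.1 hxy
      rcases hR x y hxy with h | h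
      · exact h
      · exact absurd h.1 hyv
    · obtain ⟨y, hy, hyi⟩ : ∃ y ∈ S', (S'.filter (fun x => y ∈ N' x)).card ≤ 1 := by
        by_contra hcon
        push Not at hcon
        have hdc : ∑ x ∈ S', (N' x).card = ∑ y ∈ S', (S'.filter (fun x => y ∈ N' x)).card := by
          have := Finset.sum_card_bipartiteAbove_eq_sum_card_bipartiteBelow
            (s := S') (t := S') (fun x y => y ∈ N' x)
          simp only [Finset.bipartiteAbove, Finset.bipartiteBelow] at this
          rw [← this]
          apply Finset.sum_congr rfl
          intro x hx
          congr 1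
          ext y
          simp only [Finset.mem_filter]
          exact ⟨fun h => ⟨hN' x hx h, h⟩, fun h => h.2⟩
        have h3 := Finset.add_sum_erase S' (fun y => (S'.filter (fun x => y ∈ N' x)).card) hvS'
        have h4 : (S'.erase v).card * 2 ≤
            ∑ y ∈ S'.erase v, (S'.filter (fun x => y ∈ N' x)).card :=
          Finset.card_nsmul_le_sum (S'.erase v)
            (fun y => (S'.filter (fun x => y ∈ N' x)).card) 2
            (fun x hx => hcon x (Finset.mem_of_mem_erase hx))
        have h5 := Finset.card_erase_add_one hvS'
        omega
      obtain ⟨m, z, hm, hw, hb⟩ := del_lemma S' N' hS'2 (IH _ (by omega)) hN' hall y hy 1 hyi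
        le_rfl
      have hw2 : Wk (Ro N') m z z := hw.mono (fun a b hab => Finset.mem_of_mem_erase hab)
      obtain ⟨m', z', hm', hb', hw'⟩ := lift_closed _ _ v T e hd hR m hm z hw2
      exact ⟨m', z', hm', hw', by omega⟩

theorem claim_all (V : Type*) (n : ℕ) : Claim V n := by
  classical
  induction n using Nat.strong_induction_on with
  | _ n IH =>
  intro S N hn hn1 hN h1 h2
  by_cases he : ∑ x ∈ S, (N x).card < 2 * n
  · obtain ⟨m, y, hm, hw, hb⟩ := step_lemma n IH S N hn hN h1 h2 he
    exact ⟨m, y, hm, hw, by omega⟩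
  · have hsumS : ∑ x ∈ S, (N x).card ≤ S.card * 2 := Finset.sum_le_card_nsmul _ _ _ h2
    obtain ⟨a, ha⟩ := Finset.card_pos.1 (by omega : 0 < S.card)
    have ha2 : (N a).card = 2 := by
      have h3 := Finset.add_sum_erase S (fun x => (N x).card) ha
      have h4 : ∑ x ∈ S.erase a, (N x).card ≤ (S.erase a).card * 2 :=
        Finset.sum_le_card_nsmul _ _ _ (fun x hx => h2 x (Finset.mem_of_mem_erase hx))
      have h5 := Finset.card_erase_add_one ha
      have := h2 a ha
      omega
    obtain ⟨b, hb⟩ := Finset.card_pos.1 (by omega : 0 < (N a).card)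
    let N' : V → Finset V := fun x => if x = a then (N x).erase b else N x
    have hsub : ∀ x, N' x ⊆ N x := by
      intro x
      simp only [N']
      split_ifs
      · exact Finset.erase_subset _ _
      · exact Finset.Subset.refl _
    have hcard : ∀ x, (N' x).card = if x = a then 1 else (N x).card := by
      intro x
      simp only [N']
      split_ifs with h
      · subst h
        rw [Finset.card_erase_of_mem hb, ha2]
      · rfl
    have hsum : ∑ x ∈ S, (N' x).card + 1 = ∑ x ∈ S, (N x).card := by
      rw [← Finset.add_sum_erase S _ ha, ← Finset.add_sum_erase S (fun x => (N x).card) ha]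
      have : ∑ x ∈ S.erase a, (N' x).card = ∑ x ∈ S.erase a, (N x).card := by
        apply Finset.sum_congr rfl
        intro x hx
        rw [hcard, if_neg (Finset.ne_of_mem_erase hx)]
      rw [this, hcard, if_pos rfl, ha2]
      omega
    obtain ⟨m, y, hm, hw, hb⟩ := step_lemma n IH S N' hn
      (fun x hx => (hsub x).trans (hN x hx))
      (fun x hx => by rw [hcard]; split_ifs; exact le_rfl; exact h1 x hx)
      (fun x hx => (Finset.card_le_card (hsub x)).trans (h2 x hx)) (by omega)
    exact ⟨m, y, hm, hw.mono (fun x y h => hsub x h), by omega⟩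

/-- Any loopless digraph `H` on a vertex set `S` with minimum out-degree at least `1`,
in which the number `t` of vertices of out-degree exactly `1` satisfies
`t ≤ |S| - 2k` for some `k ≥ 1`, contains a directed cycle of length at most
`|S| - k` (hence avoiding at least `k` vertices of `S`). -/
theorem stmt_8 {V : Type*} [Fintype V] (A : V → V → Prop)
    (hloop : ∀ v, ¬ A v v)
    (hdeg : ∀ v : V, 1 ≤ Nat.card {w : V // A v w})
    (k : ℕ) (hk : 1 ≤ k)
    (ht : (Nat.card {u : V // Nat.card {w : V // A u w} = 1} : ℤ) ≤
        (Fintype.card V : ℤ) - 2 * k) :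
    ∃ (m : ℕ) (c : ZMod m → V), IsCycleOn A m c ∧ m ≤ Fintype.card V - k := by
  classical
  have hch : ∀ v : V, ∃ Q : Finset V, (∀ w ∈ Q, A v w) ∧
      Q.card = if Nat.card {w : V // A v w} = 1 then 1 else 2 := by
    intro v
    have hc : (Finset.univ.filter (fun w => A v w)).card = Nat.card {w : V // A v w} := by
      rw [Nat.card_eq_fintype_card, Fintype.card_subtype]
    obtain ⟨Q, hQ, hQc⟩ := Finset.exists_subset_card_eq
      (s := Finset.univ.filter (fun w => A v w))
      (n := if Nat.card {w : V // A v w} = 1 then 1 else 2) (by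
        have := hdeg v
        rw [hc]; split_ifs <;> omega)
    exact ⟨Q, fun w hw => (Finset.mem_filter.1 (hQ hw)).2, hQc⟩
  choose N hNA hNc using hch
  have htc : Nat.card {u : V // Nat.card {w : V // A u w} = 1} =
      (Finset.univ.filter (fun u : V => Nat.card {w : V // A u w} = 1)).card := by
    rw [Nat.card_eq_fintype_card, Fintype.card_subtype]
  have hsum : ∑ x : V, (N x).card + Nat.card {u : V // Nat.card {w : V // A u w} = 1}
      = 2 * Fintype.card V := by
    rw [htc, Finset.card_filter, ← Finset.sum_add_distrib]
    rw [Finset.sum_congr rfl (g := fun _ => 2)]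
    · simp [mul_comm]
    · intro x _
      rw [hNc]; split_ifs <;> rfl
  obtain ⟨m, y, hm, hw, hb⟩ := claim_all V (Fintype.card V) Finset.univ N rfl (by omega)
    (fun x _ => Finset.subset_univ _)
    (fun x _ => by rw [hNc]; split_ifs <;> omega) (fun x _ => by rw [hNc]; split_ifs <;> omega)
  obtain ⟨m', c, hcyc, hle⟩ := exists_cycle A hloop m hm y (hw.mono (fun x z h => hNA x z h))
  exact ⟨m', c, hcyc, by omega⟩
end
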